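/- The number m(λ,μ,ν) of 3-dimensional nonnegative integer matrices with 1-marginals λ, μ, ν equals Σ_{α,β,γ} K_{αλ} K_{βμ} K_{γν} · k(α,β,γ), where the sum runs over partitions α, β, γ of n and k(α,β,γ) = ⟨χ^α ⊗ χ^β, χ^γ⟩ is the Kronecker coefficient. -/

import Mathlib

open Finset Equiv
open scoped Classical

noncomputable section

/-- Value at `g` of the permutation character of `S_n` induced from the trivial character of
the Young subgroup of the composition `c`: the number of colorings of `Fin n` with fiber
sizes given by `c` that are fixed by `g`. -/
def permChar (n : ℕ) (c : ℕ → ℕ) (g : Perm (Fin n)) : ℚ :=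
  Nat.card {f : Fin n → ℕ // (∀ k, Nat.card {x : Fin n // f x = k} = c k) ∧ ∀ x, f (g x) = f x}

/-- Inner product of class functions (real-valued characters) of `S_n`. -/
def innerChar (n : ℕ) (χ ψ : Perm (Fin n) → ℚ) : ℚ :=
  (∑ g : Perm (Fin n), χ g * ψ g) / (n.factorial : ℚ)

/-- The trivial character `χ^{(n)}` of `S_n`. -/
def trivChar (n : ℕ) : Perm (Fin n) → ℚ := fun _ => 1

/-- The sign character `χ^{(1^n)}` of `S_n`. -/
def signChar (n : ℕ) : Perm (Fin n) → ℚ := fun g => ((Perm.sign g : ℤ) : ℚ)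

/-- Permutation character for an integer vector: zero if some entry is negative. -/
def permCharZ (n : ℕ) (c : ℕ → ℤ) (g : Perm (Fin n)) : ℚ :=
  if ∀ k, 0 ≤ c k then permChar n (fun k => (c k).toNat) g else 0

/-- The irreducible character `χ^a` of `S_n` indexed by the partition `a`, given by the
Jacobi–Trudi determinantal formula `χ^a = ∑_σ sgn(σ) φ^{(a_i - i + σ(i))_i}`. -/
def irrChar (n : ℕ) (a : ℕ → ℕ) (g : Perm (Fin n)) : ℚ :=
  ∑ σ : Perm (Fin n), ((Perm.sign σ : ℤ) : ℚ) *
    permCharZ n (fun i => if h : i < n then (a i : ℤ) - i + ((σ ⟨i, h⟩ : Fin n) : ℕ) else 0) g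

/-- Kronecker coefficient `k(a,b,c) = ⟨χ^a ⊗ χ^b, χ^c⟩`. -/
def kron (n : ℕ) (a b c : ℕ → ℕ) : ℚ :=
  innerChar n (fun g => irrChar n a g * irrChar n b g) (irrChar n c)

/-- Extend a vector indexed by `Fin p` to `ℕ` by zeros. -/
def extc {p : ℕ} (l : Fin p → ℕ) : ℕ → ℕ := fun i => if h : i < p then l ⟨i, h⟩ else 0

/-- Dominance order: `a ⊵ b`. -/
def Dominates (a b : ℕ → ℕ) : Prop :=
  ∀ k, ∑ i ∈ Finset.range k, b i ≤ ∑ i ∈ Finset.range k, a i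

/-- Conjugate (transpose) of a partition with at most `n` parts. -/
def conjFun (n : ℕ) (a : ℕ → ℕ) : ℕ → ℕ :=
  fun j => ((Finset.range n).filter (fun i => j < a i)).card

/-- `a` is a partition of `n` (weakly decreasing, supported on the first `n` parts). -/
def IsPartitionFun (n : ℕ) (a : ℕ → ℕ) : Prop :=
  (∀ i j, i ≤ j → a j ≤ a i) ∧ (∀ i, n ≤ i → a i = 0) ∧ ∑ i ∈ Finset.range n, a i = n

/-- The weakly decreasing sequence of parts of `P : Nat.Partition n`. -/
def pf {n : ℕ} (P : n.Partition) : ℕ → ℕ :=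
  fun i => ((P.parts.sort (· ≤ ·)).reverse).getD i 0

/-- The parts of `P : Nat.Partition n` as a vector of length `n`. -/
def pfin {n : ℕ} (P : n.Partition) : Fin n → ℕ := fun k => pf P k

/-- Number of cells of the skew shape `a/b` where the filling `T` has entry `k`. -/
def skewContent (a b : ℕ → ℕ) (T : ℕ → ℕ → ℕ) (k : ℕ) : ℕ :=
  Nat.card {p : ℕ × ℕ // b p.1 ≤ p.2 ∧ p.2 < a p.1 ∧ T p.1 p.2 = k}

/-- Number of cells of the skew shape `a/b`. -/
def skewSize (a b : ℕ → ℕ) : ℕ :=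
  Nat.card {p : ℕ × ℕ // b p.1 ≤ p.2 ∧ p.2 < a p.1}

/-- `T` is a semistandard filling of the shape `a` (zero outside, rows weakly increasing,
columns strictly increasing). -/
def IsSSYT (a : ℕ → ℕ) (T : ℕ → ℕ → ℕ) : Prop :=
  (∀ i j, a i ≤ j → T i j = 0) ∧
  (∀ i j₁ j₂, j₁ ≤ j₂ → j₂ < a i → T i j₁ ≤ T i j₂) ∧
  (∀ i₁ i₂ j, i₁ < i₂ → j < a i₂ → T i₁ j < T i₂ j)

/-- The Kostka number: the number of semistandard Young tableaux of shape `a`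
and content `c`. -/
def kostka (a c : ℕ → ℕ) : ℕ :=
  Nat.card {T : ℕ → ℕ → ℕ // IsSSYT a T ∧ ∀ k, skewContent a (fun _ => 0) T k = c k}

/-- Number of entries equal to `k` in the prefix of the (right-to-left, top-to-bottom)
reading word of `T` ending at position `(i,j)`. -/
def lrCount (a b : ℕ → ℕ) (T : ℕ → ℕ → ℕ) (i j k : ℕ) : ℕ :=
  Nat.card {p : ℕ × ℕ //
    (p.1 < i ∨ (p.1 = i ∧ j ≤ p.2)) ∧ b p.1 ≤ p.2 ∧ p.2 < a p.1 ∧ T p.1 p.2 = k}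

/-- `T` is a Littlewood–Richardson skew tableau of shape `a/b`: semistandard and its
reverse reading word is a lattice word. -/
def IsLR (a b : ℕ → ℕ) (T : ℕ → ℕ → ℕ) : Prop :=
  (∀ i j, ¬(b i ≤ j ∧ j < a i) → T i j = 0) ∧
  (∀ i j₁ j₂, b i ≤ j₁ → j₁ ≤ j₂ → j₂ < a i → T i j₁ ≤ T i j₂) ∧
  (∀ i₁ i₂ j, i₁ < i₂ → b i₁ ≤ j → j < a i₁ → b i₂ ≤ j → j < a i₂ → T i₁ j < T i₂ j) ∧
  (∀ i j k, lrCount a b T i j (k + 1) ≤ lrCount a b T i j k)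

/-- A Littlewood–Richardson multitableau of shape `α` with `r` parts: a chain of
partitions `0 = α(0) ⊆ α(1) ⊆ ⋯ ⊆ α(r) = α` together with Littlewood–Richardson
fillings of the successive skew shapes. -/
structure LRMultiF (r : ℕ) (α : ℕ → ℕ) where
  chain : Fin (r + 1) → ℕ → ℕ
  antitone : ∀ k i j, i ≤ j → chain k j ≤ chain k i
  zero : ∀ i, chain 0 i = 0
  last : ∀ i, chain (Fin.last r) i = α i
  mono : ∀ (k : Fin r) (i : ℕ), chain k.castSucc i ≤ chain k.succ i
  T : Fin r → ℕ → ℕ → ℕ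
  lr : ∀ k : Fin r, IsLR (chain k.succ) (chain k.castSucc) (T k)

/-- Content of the `k`-th tableau of a Littlewood–Richardson multitableau. -/
def LRMultiF.cont {r : ℕ} {α : ℕ → ℕ} (M : LRMultiF r α) (k : Fin r) : ℕ → ℕ :=
  skewContent (M.chain k.succ) (M.chain k.castSucc) (M.T k)

/-- Size of the `k`-th tableau of a Littlewood–Richardson multitableau. -/
def LRMultiF.size {r : ℕ} {α : ℕ → ℕ} (M : LRMultiF r α) (k : Fin r) : ℕ :=
  skewSize (M.chain k.succ) (M.chain k.castSucc)

/-- `LR(α,β;ν)`: pairs of Littlewood–Richardson multitableaux of shapes `α`, `β`,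
type `ν`, with equal contents. -/
def LRPairs (r : ℕ) (α β : ℕ → ℕ) (ν : Fin r → ℕ) :=
  {TS : LRMultiF r α × LRMultiF r β //
    (∀ k, TS.1.size k = ν k) ∧ (∀ k, TS.2.size k = ν k) ∧ ∀ k, TS.1.cont k = TS.2.cont k}

/-- `LR*(α,β;ν)`: pairs of Littlewood–Richardson multitableaux of shapes `α`, `β`,
type `ν`, with termwise conjugate contents. -/
def LRPairsStar (n r : ℕ) (α β : ℕ → ℕ) (ν : Fin r → ℕ) :=
  {TS : LRMultiF r α × LRMultiF r β //
    (∀ k, TS.1.size k = ν k) ∧ (∀ k, TS.2.size k = ν k) ∧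
      ∀ k m, TS.2.cont k m = conjFun n (TS.1.cont k) m}

/-- `lr(α,β;ν)`. -/
def lrNum (r : ℕ) (α β : ℕ → ℕ) (ν : Fin r → ℕ) : ℕ := Nat.card (LRPairs r α β ν)

/-- `lr*(α,β;ν)`. -/
def lrStarNum (n r : ℕ) (α β : ℕ → ℕ) (ν : Fin r → ℕ) : ℕ :=
  Nat.card (LRPairsStar n r α β ν)

/-- A semistandard Young tableau (of arbitrary partition shape). -/
structure SSYTP where
  shape : ℕ → ℕ
  T : ℕ → ℕ → ℕ
  antitone : ∀ i j, i ≤ j → shape j ≤ shape i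
  finite : ∃ N, ∀ i, N ≤ i → shape i = 0
  ssyt : IsSSYT shape T

/-- Content of a semistandard Young tableau. -/
def SSYTP.cont (P : SSYTP) : ℕ → ℕ := skewContent P.shape (fun _ => 0) P.T

/-- The multiset of entries of a matrix. -/
def entriesM {p q : ℕ} (A : Fin p → Fin q → ℕ) : Multiset ℕ :=
  (Finset.univ : Finset (Fin p × Fin q)).val.map (fun ij => A ij.1 ij.2)

/-- The π-sequence of `A` is the partition `ν` (the weakly decreasing rearrangement of
the entries of `A` is `ν`). -/
def HasPiSeq {p q : ℕ} (A : Fin p → Fin q → ℕ) {n : ℕ} (ν : n.Partition) : Prop :=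
  (entriesM A).filter (· ≠ 0) = ν.parts

end

/-- The Jacobi–Trudi determinant `det (h_{a_j - j + i})`. -/
noncomputable def jtDet {R : Type*} [CommRing R] (h : ℤ → R) {N : ℕ} (a : Fin N → ℕ) : R :=
  Matrix.det (Matrix.of fun i j : Fin N => h ((a j : ℤ) - (j : ℕ) + (i : ℕ)))

theorem jtDet_eq_det_rev {R : Type*} [CommRing R] (h : ℤ → R) {N : ℕ} (a : Fin N → ℕ) :
    jtDet h a = Matrix.det (Matrix.of fun i j : Fin N =>
      h ((a j.rev : ℤ) - (j.rev : ℕ) + (i.rev : ℕ))) := by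
  rw [jtDet, ← Matrix.det_submatrix_equiv_self Fin.revPerm]
  rfl

open PowerSeries in
/-- The generating function of the Jacobi–Trudi determinants of all `a + γ`. -/
theorem coeff_det_powerSeries {R : Type*} [CommRing R] (h : ℤ → R) {N : ℕ} (a : Fin N → ℕ)
    (k : ℕ) :
    coeff k (Matrix.det (Matrix.of fun i j : Fin N =>
      PowerSeries.mk fun g : ℕ => h ((a j : ℤ) - (j : ℕ) + (i : ℕ) + g))) =
    ∑ γ ∈ finsuppAntidiag (univ : Finset (Fin N)) k, jtDet h (fun i => a i + γ i) := by
  simp only [jtDet, Matrix.det_apply', map_sum]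
  rw [Finset.sum_comm]
  refine Finset.sum_congr rfl fun σ _ => ?_
  rw [← zsmul_eq_mul, map_zsmul, coeff_prod, zsmul_eq_mul, Finset.mul_sum]
  refine Finset.sum_congr rfl fun γ _ => ?_
  congr 1
  refine Finset.prod_congr rfl fun i _ => ?_
  simp only [Matrix.of_apply, coeff_mk]
  congr 1
  push_cast
  ring

open PowerSeries in
theorem det_powerSeries {R : Type*} [CommRing R] (h : ℤ → R) (h0 : h 0 = 1)
    (hneg : ∀ m < 0, h m = 0) {N : ℕ} (a : Fin (N + 1) → ℕ) (ha : a (Fin.last N) = 0) :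
    Matrix.det (Matrix.of fun i j : Fin (N + 1) =>
      PowerSeries.mk fun g : ℕ => h ((a j : ℤ) - (j : ℕ) + (i : ℕ) + g)) =
    (PowerSeries.mk fun g : ℕ => h g) * C (jtDet h a) := by
  rw [jtDet_eq_det_rev, ← Matrix.det_submatrix_equiv_self Fin.revPerm]
  rw [Matrix.det_eq_of_forall_row_eq_smul_add_pred
    (B := Matrix.of fun i j : Fin (N + 1) => if i = 0 then
        (PowerSeries.mk fun g : ℕ => h ((a j.rev : ℤ) - (j.rev : ℕ) + N + g)) else
        C (h ((a j.rev : ℤ) - (j.rev : ℕ) + (i.rev : ℕ)))) (fun _ => X)]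
  · rw [Matrix.det_succ_column_zero, Matrix.det_succ_column_zero, Finset.sum_eq_single 0,
      Finset.sum_eq_single 0]
    · simp [ha, h0, RingHom.map_det]
      congr 1
    · intro i _ hi
      have : h ((a (Fin.rev 0) : ℤ) - (Fin.rev (0 : Fin (N + 1)) : ℕ) + (i.rev : ℕ)) = 0 := by
        apply hneg
        have : 0 < (i : ℕ) := Fin.pos_iff_ne_zero.2 hi
        simp only [Fin.rev_zero, ha, Fin.val_last, Fin.val_rev]
        omega
      simp only [Matrix.of_apply, this]
      simp
    · simp
    · intro i _ hi
      have : h ((a (Fin.rev 0) : ℤ) - (Fin.rev (0 : Fin (N + 1)) : ℕ) + (i.rev : ℕ)) = 0 := by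
        apply hneg
        have : 0 < (i : ℕ) := Fin.pos_iff_ne_zero.2 hi
        simp only [Fin.rev_zero, ha, Fin.val_last, Fin.val_rev]
        omega
      simp only [Matrix.of_apply, if_neg hi, this]
      simp
    · simp
  · intro j
    simp
  · intro i j
    ext g
    simp only [Matrix.submatrix_apply, Matrix.of_apply, Fin.revPerm_apply, coeff_mk, map_add,
      if_neg (Fin.succ_ne_zero i)]
    cases g with
    | zero => simp
    | succ g =>
      simp only [coeff_succ_X_mul, coeff_mk, coeff_C]
      simp [Fin.val_rev]
      congr 1
      have := i.2
      omega

/-- The Pieri rule before cancellation. -/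
theorem sum_jtDet_add {R : Type*} [CommRing R] (h : ℤ → R) (h0 : h 0 = 1)
    (hneg : ∀ m < 0, h m = 0) {N : ℕ} (a : Fin (N + 1) → ℕ) (ha : a (Fin.last N) = 0) (k : ℕ) :
    ∑ γ ∈ finsuppAntidiag (univ : Finset (Fin (N + 1))) k, jtDet h (fun i => a i + γ i) =
      h k * jtDet h a := by
  rw [← coeff_det_powerSeries, det_powerSeries h h0 hneg a ha, PowerSeries.coeff_mul_C,
    PowerSeries.coeff_mk]

/-- Exchange of the entries `i` and `i + 1` of the shifted vector `(a_j - j)_j`. -/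
def adjSwap {M : ℕ} (a : Fin (M + 1) → ℕ) (i : Fin M) : Fin (M + 1) → ℕ :=
  fun j => a (Equiv.swap i.castSucc i.succ j) + j - (Equiv.swap i.castSucc i.succ j : Fin (M + 1))

theorem adjSwap_castSucc {M : ℕ} (a : Fin (M + 1) → ℕ) (i : Fin M) :
    adjSwap a i i.castSucc = a i.succ - 1 := by
  simp [adjSwap]
  omega

theorem adjSwap_succ {M : ℕ} (a : Fin (M + 1) → ℕ) (i : Fin M) :
    adjSwap a i i.succ = a i.castSucc + 1 := by
  simp [adjSwap]
  omega

theorem adjSwap_of_ne {M : ℕ} (a : Fin (M + 1) → ℕ) (i : Fin M) {j : Fin (M + 1)}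
    (h₁ : j ≠ i.castSucc) (h₂ : j ≠ i.succ) : adjSwap a i j = a j := by
  simp [adjSwap, Equiv.swap_apply_of_ne_of_ne h₁ h₂]

theorem adjSwap_cast {M : ℕ} (a : Fin (M + 1) → ℕ) (i : Fin M) (hi : 0 < a i.succ)
    (j : Fin (M + 1)) : (adjSwap a i j : ℤ) = a (Equiv.swap i.castSucc i.succ j) + (j : ℕ) -
      ((Equiv.swap i.castSucc i.succ j : Fin (M + 1)) : ℕ) := by
  rcases eq_or_ne j i.castSucc with rfl | h₁
  · rw [adjSwap_castSucc]
    simp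
    omega
  rcases eq_or_ne j i.succ with rfl | h₂
  · rw [adjSwap_succ]
    simp
    ring
  · rw [adjSwap_of_ne a i h₁ h₂, Equiv.swap_apply_of_ne_of_ne h₁ h₂]
    simp

theorem sum_adjSwap {M : ℕ} (a : Fin (M + 1) → ℕ) (i : Fin M) (hi : 0 < a i.succ) :
    ∑ j, adjSwap a i j = ∑ j, a j := by
  zify
  simp only [adjSwap_cast a i hi, Finset.sum_sub_distrib, Finset.sum_add_distrib]
  rw [Equiv.sum_comp (Equiv.swap i.castSucc i.succ) (fun j => (a j : ℤ)),
    Equiv.sum_comp (Equiv.swap i.castSucc i.succ) (fun j => ((j : ℕ) : ℤ))]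
  ring

theorem adjSwap_adjSwap {M : ℕ} (a : Fin (M + 1) → ℕ) (i : Fin M) (hi : 0 < a i.succ) :
    adjSwap (adjSwap a i) i = a := by
  funext j
  rcases eq_or_ne j i.castSucc with rfl | h₁
  · rw [adjSwap_castSucc, adjSwap_succ]
    omega
  rcases eq_or_ne j i.succ with rfl | h₂
  · rw [adjSwap_succ, adjSwap_castSucc]
    omega
  · rw [adjSwap_of_ne _ i h₁ h₂, adjSwap_of_ne _ i h₁ h₂]

theorem jtDet_adjSwap {R : Type*} [CommRing R] (h : ℤ → R) {M : ℕ} (a : Fin (M + 1) → ℕ)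
    (i : Fin M) (hi : 0 < a i.succ) : jtDet h (adjSwap a i) = - jtDet h a := by
  have := Matrix.det_permute' (Equiv.swap i.castSucc i.succ)
    (Matrix.of fun i j : Fin (M + 1) => h ((a j : ℤ) - (j : ℕ) + (i : ℕ)))
  rw [Equiv.Perm.sign_swap (Fin.castSucc_lt_succ).ne] at this
  simp only [Units.val_neg, Units.val_one, Int.cast_neg, Int.cast_one, neg_mul, one_mul] at this
  rw [jtDet, jtDet, ← this]
  congr 1
  ext k j
  simp only [Matrix.of_apply, Matrix.submatrix_apply, adjSwap_cast a i hi, id]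
  congr 1
  ring

theorem jtDet_eq_zero {R : Type*} [CommRing R] (h : ℤ → R) {M : ℕ} (a : Fin (M + 1) → ℕ)
    (i : Fin M) (hi : a i.succ = a i.castSucc + 1) : jtDet h a = 0 := by
  refine Matrix.det_zero_of_column_eq (Fin.castSucc_lt_succ (i := i)).ne fun k => ?_
  simp [hi]

/-- The rows at which `a / b` fails to be a horizontal strip. -/
def stripDefects {M : ℕ} (b a : Fin (M + 1) → ℕ) : Finset (Fin M) :=
  univ.filter fun i => b i.castSucc < a i.succ

theorem mem_stripDefects {M : ℕ} {b a : Fin (M + 1) → ℕ} {i : Fin M} :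
    i ∈ stripDefects b a ↔ b i.castSucc < a i.succ := by
  simp [stripDefects]

theorem max'_stripDefects_adjSwap {M : ℕ} {b a : Fin (M + 1) → ℕ} (hba : b ≤ a)
    (hs : (stripDefects b a).Nonempty)
    (hs' : (stripDefects b (adjSwap a ((stripDefects b a).max' hs))).Nonempty) :
    (stripDefects b (adjSwap a ((stripDefects b a).max' hs))).max' hs' =
      (stripDefects b a).max' hs := by
  set i := (stripDefects b a).max' hs with hi
  have hmem : i ∈ stripDefects b a := Finset.max'_mem _ _
  apply le_antisymm
  · refine Finset.max'_le _ _ _ fun k hk => ?_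
    by_contra! hik
    rw [mem_stripDefects, adjSwap_of_ne a i (by simp [Fin.ext_iff]; omega)
      (by simp [Fin.ext_iff]; omega)] at hk
    exact absurd (Finset.le_max' _ k (mem_stripDefects.2 hk)) (not_le.2 hik)
  · refine Finset.le_max' _ _ ?_
    rw [mem_stripDefects, adjSwap_succ]
    exact Nat.lt_succ_of_le (hba _)

theorem sum_jtDet_defects {R : Type*} [CommRing R] (h : ℤ → R) {M : ℕ} (b : Fin (M + 1) → ℕ)
    (hb : Antitone b) (s : ℕ) :
    ∑ a ∈ ((piAntidiag univ s).filter fun a => b ≤ a ∧ (stripDefects b a).Nonempty),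
      jtDet h a = 0 := by
  have key : ∀ a : Fin (M + 1) → ℕ, ∀ hs : (stripDefects b a).Nonempty,
      b ((stripDefects b a).max' hs).castSucc < a ((stripDefects b a).max' hs).succ :=
    fun a hs => mem_stripDefects.1 (Finset.max'_mem _ _)
  refine Finset.sum_involution
    (fun a ha => adjSwap a ((stripDefects b a).max' (Finset.mem_filter.1 ha).2.2)) ?_ ?_ ?_ ?_
  · intro a ha
    rw [jtDet_adjSwap h a _ (Nat.zero_lt_of_lt (key a _)), add_neg_cancel]
  · intro a ha hne heq
    apply hne
    apply jtDet_eq_zero h a ((stripDefects b a).max' (Finset.mem_filter.1 ha).2.2)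
    have := congrFun heq ((stripDefects b a).max' (Finset.mem_filter.1 ha).2.2).succ
    rw [adjSwap_succ] at this
    exact this.symm
  · intro a ha
    obtain ⟨hsum, hba, hs⟩ := Finset.mem_filter.1 ha
    have hk := key a hs
    rw [Finset.mem_filter]
    refine ⟨?_, ?_, ?_⟩
    · rw [mem_piAntidiag] at hsum ⊢
      exact ⟨by rw [sum_adjSwap a _ (Nat.zero_lt_of_lt hk)]; exact hsum.1, by simp⟩
    · intro j
      set i := (stripDefects b a).max' hs
      rcases eq_or_ne j i.castSucc with rfl | h₁
      · change b _ ≤ adjSwap a i _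
        rw [adjSwap_castSucc]
        omega
      rcases eq_or_ne j i.succ with rfl | h₂
      · change b _ ≤ adjSwap a i _
        rw [adjSwap_succ]
        have h1 := hb (Fin.castSucc_lt_succ (i := i)).le
        have h2 : b i.castSucc ≤ a i.castSucc := hba i.castSucc
        omega
      · rw [adjSwap_of_ne _ i h₁ h₂]
        exact hba j
    · refine ⟨(stripDefects b a).max' hs, mem_stripDefects.2 ?_⟩
      rw [adjSwap_succ]
      exact Nat.lt_succ_of_le (hba _)
  · intro a ha
    obtain ⟨hsum, hba, hs⟩ := Finset.mem_filter.1 ha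
    simp only [max'_stripDefects_adjSwap hba hs]
    exact adjSwap_adjSwap a _ (Nat.zero_lt_of_lt (key a _))

/-- `a / b` is a horizontal strip. -/
def IsHStrip {M : ℕ} (b a : Fin M → ℕ) : Prop :=
  b ≤ a ∧ ∀ i j : Fin M, i < j → a j ≤ b i

theorem isHStrip_iff {M : ℕ} {b a : Fin (M + 1) → ℕ} (hb : Antitone b) :
    IsHStrip b a ↔ b ≤ a ∧ ¬ (stripDefects b a).Nonempty := by
  rw [IsHStrip, Finset.not_nonempty_iff_eq_empty, Finset.eq_empty_iff_forall_notMem]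
  refine and_congr_right fun _ => ⟨fun h i => ?_, fun h i j hij => ?_⟩
  · rw [mem_stripDefects, not_lt]
    exact h _ _ (Fin.castSucc_lt_succ)
  · obtain ⟨k, rfl⟩ := Fin.exists_succ_eq.2 (Fin.ne_zero_of_lt hij)
    have := h k
    rw [mem_stripDefects, not_lt] at this
    exact this.trans (hb (by rw [Fin.le_def]; rw [Fin.lt_def] at hij; simp at hij ⊢; omega))

theorem sum_jtDet_add_eq_sum_strip {R : Type*} [CommRing R] (h : ℤ → R) {N : ℕ}
    (b : Fin (N + 1) → ℕ) (hb : Antitone b) (k : ℕ) :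
    ∑ γ ∈ finsuppAntidiag (univ : Finset (Fin (N + 1))) k, jtDet h (fun i => b i + γ i) =
      ∑ a ∈ (piAntidiag univ (∑ i, b i + k)).filter fun a => IsHStrip b a, jtDet h a := by
  have e : ∑ γ ∈ finsuppAntidiag (univ : Finset (Fin (N + 1))) k,
      jtDet h (fun i => b i + γ i) =
      ∑ a ∈ (piAntidiag univ (∑ i, b i + k)).filter fun a => b ≤ a, jtDet h a := by
    refine Finset.sum_bij' (fun γ _ i => b i + γ i)
      (fun a _ => Finsupp.equivFunOnFinite.symm fun i => a i - b i) ?_ ?_ ?_ ?_ ?_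
    · intro γ hγ
      rw [mem_finsuppAntidiag] at hγ
      simp only [Finset.mem_filter, mem_piAntidiag]
      refine ⟨⟨?_, by simp⟩, fun i => Nat.le_add_right _ _⟩
      rw [Finset.sum_add_distrib, hγ.1]
    · intro a ha
      simp only [Finset.mem_filter, mem_piAntidiag] at ha
      rw [mem_finsuppAntidiag]
      refine ⟨?_, by simp⟩
      have : ∑ i, (a i - b i) + ∑ i, b i = ∑ i, a i := by
        rw [← Finset.sum_add_distrib]
        exact Finset.sum_congr rfl fun i _ => Nat.sub_add_cancel (ha.2 i)
      have hsum : ∑ i, a i = ∑ i, b i + k := ha.1.1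
      simp only [Finsupp.equivFunOnFinite_symm_apply_apply]
      omega
    · intro γ _
      ext i
      simp
    · intro a ha
      simp only [Finset.mem_filter] at ha
      funext i
      simp [Nat.add_sub_cancel' (ha.2 i)]
    · intros
      rfl
  rw [e, ← Finset.sum_filter_add_sum_filter_not _ (fun a => (stripDefects b a).Nonempty),
    Finset.filter_filter, sum_jtDet_defects h b hb, zero_add, Finset.filter_filter]
  refine Finset.sum_congr ?_ fun _ _ => rfl
  ext a
  simp only [Finset.mem_filter, isHStrip_iff hb]

/-- The Pieri rule for Jacobi–Trudi determinants with sufficiently many rows. -/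
theorem jtDet_pieri {R : Type*} [CommRing R] (h : ℤ → R) (h0 : h 0 = 1)
    (hneg : ∀ m < 0, h m = 0) {N : ℕ} (b : Fin N → ℕ) (hb : Antitone b) (k : ℕ)
    (hk : ∑ i, b i + k ≤ N) :
    h k * jtDet h b =
      ∑ a ∈ (piAntidiag univ (∑ i, b i + k)).filter fun a => IsHStrip b a, jtDet h a := by
  cases N with
  | zero =>
    obtain rfl : k = 0 := by simpa using hk
    rw [Finset.sum_eq_single b]
    · simp [h0]
    · intro a _ hab
      exact absurd (Subsingleton.elim _ _) hab
    · intro hmem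
      refine absurd ?_ hmem
      simp only [Finset.mem_filter, mem_piAntidiag]
      exact ⟨⟨by simp, by simp⟩, le_rfl, fun i => i.elim0⟩
  | succ N =>
    rw [← sum_jtDet_add_eq_sum_strip h b hb]
    rcases Nat.eq_zero_or_pos k with rfl | hpos
    · simp [h0]
    · refine (sum_jtDet_add h h0 hneg b ?_ k).symm
      by_contra hne
      have : ∑ _i : Fin (N + 1), 1 ≤ ∑ i, b i :=
        Finset.sum_le_sum fun i _ => (Nat.pos_of_ne_zero hne).trans_le (hb (Fin.le_last i))
      simp at this
      omega

theorem skewContent_eq_sum {N : ℕ} {A : ℕ → ℕ} (hA : ∀ i, N ≤ i → A i = 0) (T : ℕ → ℕ → ℕ)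
    (k : ℕ) : skewContent A (fun _ => 0) T k =
      ∑ i ∈ range N, #{j ∈ range (A i) | T i j = k} := by
  rw [← Finset.card_sigma, skewContent, ← Nat.card_eq_finsetCard]
  refine Nat.card_congr ((Equiv.sigmaEquivProd ℕ ℕ).symm.subtypeEquiv fun x => ?_)
  simp only [Nat.zero_le, true_and, Finset.mem_sigma, Finset.mem_range, Finset.mem_filter]
  refine ⟨fun h => ⟨?_, h⟩, fun h => h.2⟩
  by_contra! hN
  have := hA x.1 hN
  change x.2 < A x.1 ∧ _ at h
  omega

theorem mem_iff_lt_card {S : Finset ℕ} (hS : ∀ i j, i ≤ j → j ∈ S → i ∈ S) (j : ℕ) :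
    j ∈ S ↔ j < #S := by
  constructor
  · intro hj
    have : range (j + 1) ⊆ S := fun i hi => hS i j (Nat.lt_succ_iff.1 (mem_range.1 hi)) hj
    simpa using card_le_card this
  · intro hj
    by_contra hn
    have : S ⊆ range j := fun i hi => mem_range.2 (by
      by_contra! hji
      exact hn (hS j i hji hi))
    have := card_le_card this
    rw [card_range] at this
    omega

/-- The length of the part of row `i` of `T` with entries less than `p`. -/
noncomputable def rowLenBelow (A : ℕ → ℕ) (T : ℕ → ℕ → ℕ) (p i : ℕ) : ℕ :=
  #{j ∈ range (A i) | T i j < p}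

theorem lt_rowLenBelow {A : ℕ → ℕ} {T : ℕ → ℕ → ℕ} (hT : IsSSYT A T) (p i j : ℕ) :
    j < rowLenBelow A T p i ↔ j < A i ∧ T i j < p := by
  rw [rowLenBelow, ← mem_iff_lt_card]
  · simp
  · intro j₁ j₂ h12 hj
    simp only [Finset.mem_filter, Finset.mem_range] at hj ⊢
    exact ⟨by omega, (hT.2.1 i j₁ j₂ h12 hj.1).trans_lt hj.2⟩

theorem entry_lt_of_content {N p : ℕ} {A c : ℕ → ℕ} (hA : ∀ i, N ≤ i → A i = 0)
    {T : ℕ → ℕ → ℕ} (hT : ∀ k, skewContent A (fun _ => 0) T k = c k)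
    (hc : ∀ k, p ≤ k → c k = 0) {i j : ℕ} (hj : j < A i) : T i j < p := by
  by_contra! hp
  have h := hT (T i j)
  rw [hc _ hp, skewContent_eq_sum hA, Finset.sum_eq_zero_iff] at h
  have hi : i ∈ range N := by
    rw [mem_range]
    by_contra! hN
    have := hA i hN
    omega
  have := h i hi
  rw [Finset.card_eq_zero, Finset.filter_eq_empty_iff] at this
  exact this (mem_range.2 hj) rfl

theorem sum_rowLenBelow {N p : ℕ} {A c : ℕ → ℕ} (hA : ∀ i, N ≤ i → A i = 0)
    {T : ℕ → ℕ → ℕ} (hT : ∀ k, skewContent A (fun _ => 0) T k = c k) :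
    ∑ i ∈ range N, rowLenBelow A T p i = ∑ k ∈ range p, c k := by
  simp only [← hT, skewContent_eq_sum hA]
  rw [Finset.sum_comm]
  refine Finset.sum_congr rfl fun i _ => ?_
  rw [rowLenBelow, Finset.card_eq_sum_card_fiberwise (f := T i) (t := range p)]
  · refine Finset.sum_congr rfl fun k hk => ?_
    rw [Finset.filter_filter]
    congr 1
    ext j
    simp only [Finset.mem_filter, Finset.mem_range] at hk ⊢
    omega
  · intro j hj
    simp at hj ⊢
    exact hj.2

/-- Removing the entries equal to `p` from a semistandard tableau with entries at most `p`. -/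
noncomputable def ssytTruncEquiv {N p : ℕ} {A B c c' : ℕ → ℕ} (hA : ∀ i, N ≤ i → A i = 0)
    (hBA : ∀ i, B i ≤ A i) (hAB : ∀ i i', i < i' → A i' ≤ B i)
    (hc : ∀ k, p ≤ k → c k = 0) (hc' : ∀ k, p < k → c' k = 0) (hcc' : ∀ k < p, c' k = c k)
    (hsum : ∑ i ∈ range N, A i = ∑ i ∈ range N, B i + c' p) :
    {T : ℕ → ℕ → ℕ // (IsSSYT A T ∧ ∀ k, skewContent A (fun _ => 0) T k = c' k) ∧
      ∀ i, rowLenBelow A T p i = B i} ≃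
    {T : ℕ → ℕ → ℕ // IsSSYT B T ∧ ∀ k, skewContent B (fun _ => 0) T k = c k} where
  toFun T := ⟨fun i j => if j < B i then T.1 i j else 0, by
    obtain ⟨T, ⟨hT, hTc⟩, hTB⟩ := T
    have hB : ∀ i, N ≤ i → B i = 0 := fun i hi => by
      have h1 := hA i hi
      have h2 := hBA i
      omega
    have hlt : ∀ i j, j < B i ↔ j < A i ∧ T i j < p := fun i j => by
      rw [← hTB, lt_rowLenBelow hT]
    refine ⟨⟨?_, ?_, ?_⟩, ?_⟩
    · intro i j hij
      simp [not_lt.2 hij]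
    · intro i j₁ j₂ h12 h2
      simp only [h2, lt_of_le_of_lt h12 h2, if_true]
      exact hT.2.1 i j₁ j₂ h12 (h2.trans_le (hBA i))
    · intro i₁ i₂ j h12 h2
      have h2' := h2.trans_le (hBA i₂)
      simp only [h2, h2'.trans_le (hAB i₁ i₂ h12), if_true]
      exact hT.2.2 i₁ i₂ j h12 h2'
    · intro k
      rw [skewContent_eq_sum hB]
      rcases lt_or_ge k p with hk | hk
      · rw [← hcc' k hk, ← hTc k, skewContent_eq_sum hA]
        refine Finset.sum_congr rfl fun i _ => ?_
        congr 1
        ext j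
        have := hlt i j
        simp only [Finset.mem_filter, Finset.mem_range]
        split_ifs <;> omega
      · rw [hc k hk]
        refine Finset.sum_eq_zero fun i _ => ?_
        rw [Finset.card_eq_zero, Finset.filter_eq_empty_iff]
        intro j hj
        have := hlt i j
        rw [mem_range] at hj
        simp only [hj, if_true]
        omega⟩
  invFun T := ⟨fun i j => if j < B i then T.1 i j else if j < A i then p else 0, by
    obtain ⟨T, hT, hTc⟩ := T
    have hB : ∀ i, N ≤ i → B i = 0 := fun i hi => by
      have h1 := hA i hi
      have h2 := hBA i
      omega
    have hlt : ∀ i j, j < B i → T i j < p := fun i j hj => entry_lt_of_content hB hTc hc hj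
    have hrow : ∀ i, rowLenBelow A
        (fun i j => if j < B i then T i j else if j < A i then p else 0) p i = B i := by
      intro i
      refine Eq.trans ?_ (card_range (B i))
      rw [rowLenBelow]
      congr 1
      ext j
      have h1 := hlt i j
      have h2 := hBA i
      simp only [Finset.mem_filter, Finset.mem_range]
      split_ifs <;> omega
    dsimp only
    refine ⟨⟨⟨?_, ?_, ?_⟩, ?_⟩, hrow⟩
    · intro i j hij
      have h2 := hBA i
      simp only
      split_ifs <;> omega
    · intro i j₁ j₂ h12 h2
      have h3 := hT.2.1 i j₁ j₂ h12
      have h1 := hlt i j₁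
      simp only
      split_ifs <;> omega
    · intro i₁ i₂ j h12 h2
      have h3 := hT.2.2 i₁ i₂ j h12
      have h4 := hlt i₁ j
      have h5 := hAB i₁ i₂ h12
      simp only
      split_ifs <;> omega
    · intro k
      rw [skewContent_eq_sum hA]
      rcases lt_trichotomy k p with hk | rfl | hk
      · rw [hcc' k hk, ← hTc k, skewContent_eq_sum hB]
        refine Finset.sum_congr rfl fun i _ => ?_
        congr 1
        ext j
        have := hlt i j
        have h2 := hBA i
        simp only [Finset.mem_filter, Finset.mem_range]
        split_ifs <;> omega
      · have : ∀ i ∈ range N, #{j ∈ range (A i) |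
            (if j < B i then T i j else if j < A i then k else 0) = k} + B i = A i := by
          intro i _
          have h2 := hBA i
          have e : (range (A i)).filter (fun j =>
              (if j < B i then T i j else if j < A i then k else 0) = k) =
              range (A i) \ range (B i) := by
            ext j
            have := hlt i j
            simp only [Finset.mem_filter, Finset.mem_range, Finset.mem_sdiff]
            split_ifs <;> omega
          rw [e, Finset.card_sdiff_of_subset (range_subset_range.2 h2), card_range, card_range]
          omega
        have := Finset.sum_congr rfl this
        rw [Finset.sum_add_distrib] at this
        change _ = ∑ i ∈ range N, A i at this
        omega
      · rw [hc' k hk]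
        refine Finset.sum_eq_zero fun i _ => ?_
        rw [Finset.card_eq_zero, Finset.filter_eq_empty_iff]
        intro j hj
        have := hlt i j
        rw [mem_range] at hj
        split_ifs <;> omega⟩
  left_inv T := by
    obtain ⟨T, ⟨hT, hTc⟩, hTB⟩ := T
    apply Subtype.ext
    funext i j
    have hlt : j < B i ↔ j < A i ∧ T i j < p := by
      rw [← hTB, lt_rowLenBelow hT]
    have h0 := hT.1 i j
    have hp : j < A i → T i j < p + 1 := fun hj => entry_lt_of_content hA hTc hc' hj
    simp only
    split_ifs <;> omega
  right_inv T := by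
    obtain ⟨T, hT, hTc⟩ := T
    apply Subtype.ext
    funext i j
    have h0 := hT.1 i j
    simp only
    split_ifs <;> omega

theorem extc_fin {p : ℕ} (l : Fin p → ℕ) (i : Fin p) : extc l i = l i := by
  simp [extc]

theorem extc_of_le {p : ℕ} (l : Fin p → ℕ) {i : ℕ} (hi : p ≤ i) : extc l i = 0 := by
  simp [extc, not_lt.2 hi]

theorem sum_range_extc {p : ℕ} (l : Fin p → ℕ) : ∑ i ∈ range p, extc l i = ∑ i, l i := by
  rw [← Fin.sum_univ_eq_sum_range]
  simp only [extc_fin]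

theorem extc_castSucc {p : ℕ} (l : Fin (p + 1) → ℕ) {i : ℕ} (hi : i < p) :
    extc (fun i : Fin p => l i.castSucc) i = extc l i := by
  simp only [extc, hi, hi.trans (Nat.lt_succ_self p), dif_pos]
  rfl

theorem IsHStrip.extc_le {N : ℕ} {b a : Fin N → ℕ} (h : IsHStrip b a) (i : ℕ) :
    extc b i ≤ extc a i := by
  by_cases hi : i < N
  · simpa [extc, hi] using h.1 ⟨i, hi⟩
  · simp [extc, hi]

theorem IsHStrip.extc_le_of_lt {N : ℕ} {b a : Fin N → ℕ} (h : IsHStrip b a) {i i' : ℕ}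
    (hi : i < i') : extc a i' ≤ extc b i := by
  by_cases hi' : i' < N
  · simpa [extc, hi', hi.trans hi'] using h.2 ⟨i, hi.trans hi'⟩ ⟨i', hi'⟩ hi
  · simp [extc, hi']

/-- The semistandard tableaux of shape `a` and content `l`. -/
abbrev SSYTOf {N p : ℕ} (a : Fin N → ℕ) (l : Fin p → ℕ) : Type :=
  {T : ℕ → ℕ → ℕ // IsSSYT (extc a) T ∧ ∀ k, skewContent (extc a) (fun _ => 0) T k = extc l k}

/-- The shapes obtained by removing a horizontal strip from `a`, leaving `s` cells. -/
noncomputable def stripRemovals {N : ℕ} (a : Fin N → ℕ) (s : ℕ) : Finset (Fin N → ℕ) :=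
  (piAntidiag univ s).filter fun b => IsHStrip b a

theorem mem_stripRemovals {N : ℕ} {a b : Fin N → ℕ} {s : ℕ} :
    b ∈ stripRemovals a s ↔ ∑ i, b i = s ∧ IsHStrip b a := by
  simp [stripRemovals, mem_piAntidiag]

theorem rowLenBelow_mem_stripRemovals {N p : ℕ} (a : Fin N → ℕ) (ha : Antitone a)
    (l : Fin (p + 1) → ℕ)
    (T : SSYTOf a l) : (fun i : Fin N => rowLenBelow (extc a) T.1 p i) ∈
      stripRemovals a (∑ i : Fin p, l i.castSucc) := by
  obtain ⟨T, hT, hTc⟩ := T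
  rw [mem_stripRemovals]
  refine ⟨?_, fun i => ?_, fun i j hij => ?_⟩
  · rw [Fin.sum_univ_eq_sum_range (fun i => rowLenBelow (extc a) T p i),
      sum_rowLenBelow (fun i hi => extc_of_le a hi) hTc, ← sum_range_extc]
    exact Finset.sum_congr rfl fun i hi => (extc_castSucc l (mem_range.1 hi)).symm
  · refine (card_filter_le _ _).trans ?_
    rw [card_range, extc_fin]
  · by_contra! hlt
    dsimp only at hlt
    rw [← extc_fin a j] at hlt
    have hx : rowLenBelow (extc a) T p i < extc a i :=
      hlt.trans_le (by simpa only [extc_fin] using ha hij.le)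
    have h1 := (lt_rowLenBelow hT p i _).not.1 (lt_irrefl (rowLenBelow (extc a) T p i))
    have h2 := hT.2.2 i j _ hij hlt
    have h3 := entry_lt_of_content (fun i hi => extc_of_le a hi) hTc
      (fun k hk => extc_of_le l hk) hlt
    omega

/-- Removing the largest entry from semistandard tableaux of given shape and content. -/
noncomputable def ssytOfEquiv {N p : ℕ} (a : Fin N → ℕ) (ha : Antitone a) (l : Fin (p + 1) → ℕ)
    (hal : ∑ i, a i = ∑ i, l i) :
    SSYTOf a l ≃ Σ b : stripRemovals a (∑ i : Fin p, l i.castSucc),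
      SSYTOf b.1 (fun i : Fin p => l i.castSucc) :=
  (Equiv.sigmaFiberEquiv fun T : SSYTOf a l =>
    (⟨_, rowLenBelow_mem_stripRemovals a ha l T⟩ :
      stripRemovals a (∑ i : Fin p, l i.castSucc))).symm.trans <|
  Equiv.sigmaCongrRight fun b =>
    ((Equiv.subtypeEquivRight fun T => by
      rw [Subtype.ext_iff, funext_iff]
      change (∀ i : Fin N, rowLenBelow (extc a) T.1 p i = b.1 i) ↔
        ∀ i, rowLenBelow (extc a) T.1 p i = extc b.1 i
      refine ⟨fun h i => ?_, fun h i => by rw [h, extc_fin]⟩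
      by_cases hi : i < N
      · rw [h ⟨i, hi⟩, ← extc_fin b.1]
      · rw [extc_of_le b.1 (not_lt.1 hi), rowLenBelow, extc_of_le a (not_lt.1 hi)]
        simp).trans
    (Equiv.subtypeSubtypeEquivSubtypeInter _
      (fun T => ∀ i, rowLenBelow (extc a) T p i = extc b.1 i))).trans
    (ssytTruncEquiv (N := N) (p := p) (fun i hi => extc_of_le a hi)
      (mem_stripRemovals.1 b.2).2.extc_le (fun _ _ => (mem_stripRemovals.1 b.2).2.extc_le_of_lt)
      (fun k hk => extc_of_le _ hk) (fun k hk => extc_of_le l hk)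
      (fun k hk => (extc_castSucc l hk).symm) (by
        rw [sum_range_extc, sum_range_extc, hal, (mem_stripRemovals.1 b.2).1,
          Fin.sum_univ_castSucc]
        congr 1
        exact (extc_fin l (Fin.last p)).symm))

theorem IsHStrip.antitone_left {N : ℕ} {b a : Fin N → ℕ} (h : IsHStrip b a) : Antitone b :=
  antitone_iff_forall_lt.2 fun i j hij => (h.1 j).trans (h.2 i j hij)

theorem IsHStrip.antitone_right {N : ℕ} {b a : Fin N → ℕ} (h : IsHStrip b a) : Antitone a :=
  antitone_iff_forall_lt.2 fun i j hij => (h.2 i j hij).trans (h.1 i)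

theorem extc_eq_zero_of_sum_eq_zero {N : ℕ} {a : Fin N → ℕ} (h : ∑ i, a i = 0) :
    extc a = fun _ => 0 := by
  have : a = fun _ => 0 := by simpa [funext_iff] using h
  subst this
  funext i
  simp [extc]

theorem isSSYT_zero_iff {T : ℕ → ℕ → ℕ} : IsSSYT (fun _ => 0) T ↔ T = fun _ _ => 0 := by
  refine ⟨fun h => ?_, ?_⟩
  · funext i j
    exact h.1 i j (Nat.zero_le j)
  · rintro rfl
    simp [IsSSYT]

theorem card_ssytOf_zero {N : ℕ} (a : Fin N → ℕ) (l : Fin 0 → ℕ) (h : ∑ i, a i = 0) :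
    Nat.card (SSYTOf a l) = 1 := by
  rw [Nat.card_eq_one_iff_unique]
  have hl : extc l = fun _ => 0 := by
    funext i
    simp [extc]
  simp only [SSYTOf, extc_eq_zero_of_sum_eq_zero h, isSSYT_zero_iff, hl]
  refine ⟨⟨fun T T' => Subtype.ext (T.2.1.trans T'.2.1.symm)⟩, ⟨⟨_, rfl, fun k => ?_⟩⟩⟩
  simp [skewContent]

theorem finite_ssytOf {N p : ℕ} (a : Fin N → ℕ) (ha : Antitone a) (l : Fin p → ℕ)
    (hal : ∑ i, a i = ∑ i, l i) : Finite (SSYTOf a l) := by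
  induction p generalizing a with
  | zero => exact Nat.finite_of_card_ne_zero (by simp [card_ssytOf_zero a l (by simpa using hal)])
  | succ p ih =>
    have (b : stripRemovals a (∑ i : Fin p, l i.castSucc)) :
        Finite (SSYTOf b.1 (fun i : Fin p => l i.castSucc)) :=
      ih b.1 (mem_stripRemovals.1 b.2).2.antitone_left _ (mem_stripRemovals.1 b.2).1
    exact Finite.of_equiv _ (ssytOfEquiv a ha l hal).symm

theorem kostka_succ {N p : ℕ} (a : Fin N → ℕ) (ha : Antitone a) (l : Fin (p + 1) → ℕ)
    (hal : ∑ i, a i = ∑ i, l i) :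
    kostka (extc a) (extc l) = ∑ b ∈ stripRemovals a (∑ i : Fin p, l i.castSucc),
      kostka (extc b) (extc fun i : Fin p => l i.castSucc) := by
  have (b : stripRemovals a (∑ i : Fin p, l i.castSucc)) :
      Finite (SSYTOf b.1 (fun i : Fin p => l i.castSucc)) :=
    finite_ssytOf b.1 (mem_stripRemovals.1 b.2).2.antitone_left _ (mem_stripRemovals.1 b.2).1
  rw [kostka, Nat.card_congr (ssytOfEquiv a ha l hal), Nat.card_sigma, Finset.univ_eq_attach,
    Finset.sum_attach _ (fun b => Nat.card (SSYTOf b (fun i : Fin p => l i.castSucc)))]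
  rfl

/-- Expansion of a product of the `h_k` into Jacobi–Trudi determinants. -/
theorem prod_eq_sum_kostka_mul_jtDet {R : Type*} [CommRing R] (h : ℤ → R) (h0 : h 0 = 1)
    (hneg : ∀ m < 0, h m = 0) {N p : ℕ} (l : Fin p → ℕ) (hl : ∑ i, l i ≤ N) :
    ∏ i, h (l i) = ∑ a ∈ (piAntidiag (univ : Finset (Fin N)) (∑ i, l i)).filter Antitone,
      (kostka (extc a) (extc l) : R) * jtDet h a := by
  induction p with
  | zero =>
    rw [Finset.sum_eq_single (fun _ => 0)]
    · have : kostka (extc fun _ : Fin N => 0) (extc l) = 1 :=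
        card_ssytOf_zero (fun _ => 0) l (by simp)
      rw [this, jtDet, Matrix.det_of_isLowerTriangular]
      · simp [h0]
      · intro i j hij
        apply hneg
        simp at hij ⊢
        omega
    · intro a ha hne
      simp only [Finset.mem_filter, mem_piAntidiag, Finset.univ_eq_empty, Finset.sum_empty] at ha
      exact absurd (by simpa [funext_iff] using ha.1.1) hne
    · intro hmem
      refine absurd ?_ hmem
      simp [antitone_const]
      rfl
  | succ p ih =>
    rw [Fin.sum_univ_castSucc] at hl
    rw [Fin.prod_univ_castSucc, ih (fun i => l i.castSucc) (by omega), Finset.sum_mul]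
    have step : ∀ b ∈ (piAntidiag (univ : Finset (Fin N))
        (∑ i : Fin p, l i.castSucc)).filter Antitone,
        (kostka (extc b) (extc fun i : Fin p => l i.castSucc) : R) * jtDet h b *
          h (l (Fin.last p)) =
        ∑ a ∈ (piAntidiag univ (∑ i, l i)).filter fun a => IsHStrip b a,
          (kostka (extc b) (extc fun i : Fin p => l i.castSucc) : R) * jtDet h a := by
      intro b hb
      simp only [Finset.mem_filter, mem_piAntidiag] at hb
      have hbs : ∑ i, b i = _ := hb.1.1
      rw [mul_assoc, mul_comm (jtDet h b), jtDet_pieri h h0 hneg b hb.2 _ (by omega),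
        Finset.mul_sum, hbs, Fin.sum_univ_castSucc]
    rw [Finset.sum_congr rfl step, Finset.sum_comm' (s' := fun a =>
      stripRemovals a (∑ i : Fin p, l i.castSucc))
      (t' := (piAntidiag (univ : Finset (Fin N)) (∑ i, l i)).filter Antitone)]
    · refine Finset.sum_congr rfl fun a ha => ?_
      simp only [Finset.mem_filter, mem_piAntidiag] at ha
      rw [kostka_succ a ha.2 l ha.1.1, Nat.cast_sum, Finset.sum_mul]
    · intro b a
      simp only [Finset.mem_filter, mem_piAntidiag, mem_stripRemovals]
      constructor
      · rintro ⟨⟨⟨hb, _⟩, _⟩, ⟨ha, hba⟩⟩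
        exact ⟨⟨hb, hba⟩, ha, hba.antitone_right⟩
      · rintro ⟨⟨hb, hba⟩, ha, _⟩
        exact ⟨⟨⟨hb, by simp⟩, hba.antitone_left⟩, ha, hba⟩

theorem extc_lt_of_fiber_card {n p : ℕ} {l : Fin p → ℕ} {f : Fin n → ℕ}
    (hf : ∀ k, Nat.card {x : Fin n // f x = k} = extc l k) (x : Fin n) : f x < p := by
  by_contra! h
  have := hf (f x)
  rw [extc_of_le l h, Nat.card_eq_zero] at this
  rcases this with h' | h'
  · exact h'.false ⟨x, rfl⟩
  · exact h'.not_finite inferInstance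

theorem permChar_extc {n p : ℕ} (l : Fin p → ℕ) (g : Perm (Fin n)) :
    permChar n (extc l) g =
      Nat.card {f : Fin n → Fin p // (∀ k, Nat.card {x : Fin n // f x = k} = l k) ∧
        ∀ x, f (g x) = f x} := by
  rw [permChar, Nat.cast_inj]
  refine Nat.card_congr
    { toFun := fun f => ⟨fun x => ⟨f.1 x, extc_lt_of_fiber_card f.2.1 x⟩, fun k => ?_, fun x => ?_⟩
      invFun := fun f => ⟨fun x => f.1 x, fun k => ?_, fun x => ?_⟩
      left_inv := fun f => rfl
      right_inv := fun f => rfl }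
  · rw [← extc_fin l, ← f.2.1 k]
    simp only [Fin.ext_iff]
  · simp only [f.2.2]
  · by_cases hk : k < p
    · have := f.2.1 ⟨k, hk⟩
      simp only [Fin.ext_iff] at this
      rw [this, extc, dif_pos hk]
    · rw [extc_of_le l (not_lt.1 hk), Nat.card_eq_zero]
      exact Or.inl ⟨fun x => hk (x.2 ▸ (f.1 x.1).2)⟩
  · exact congrArg Fin.val (f.2.2 x)

/-- The exponent vector of the squarefree monomial with support `S`. -/
noncomputable def indExp {n : ℕ} (S : Finset (Fin n)) : Fin n →₀ ℕ :=
  Finsupp.equivFunOnFinite.symm fun x => if x ∈ S then 1 else 0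

theorem indExp_apply {n : ℕ} (S : Finset (Fin n)) (x : Fin n) :
    indExp S x = if x ∈ S then 1 else 0 := rfl

/-- The generating polynomial of the `g`-invariant subsets with `m` elements. -/
noncomputable def invSubsetPoly {n : ℕ} (g : Perm (Fin n)) (m : ℤ) : MvPolynomial (Fin n) ℚ :=
  ∑ S ∈ univ.filter fun S : Finset (Fin n) => (#S : ℤ) = m ∧ ∀ x, g x ∈ S ↔ x ∈ S,
    MvPolynomial.monomial (indExp S) 1

theorem invSubsetPoly_zero {n : ℕ} (g : Perm (Fin n)) : invSubsetPoly g 0 = 1 := by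
  have h : univ.filter (fun S : Finset (Fin n) => (#S : ℤ) = 0 ∧ ∀ x, g x ∈ S ↔ x ∈ S) = {∅} := by
    ext S
    simp only [Finset.mem_filter, Finset.mem_univ, true_and, Nat.cast_eq_zero,
      Finset.card_eq_zero, Finset.mem_singleton]
    exact ⟨fun h => h.1, fun h => by simp [h]⟩
  have h0 : indExp (∅ : Finset (Fin n)) = 0 := by
    ext x
    simp [indExp_apply]
  rw [invSubsetPoly, h, Finset.sum_singleton, h0]
  rfl

theorem invSubsetPoly_of_neg {n : ℕ} (g : Perm (Fin n)) (m : ℤ) (hm : m < 0) :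
    invSubsetPoly g m = 0 := by
  rw [invSubsetPoly, Finset.filter_eq_empty_iff.2, Finset.sum_empty]
  rintro S _ ⟨h, _⟩
  omega

/-- The coefficient of the product of all variables. -/
noncomputable def coeffOnes (n : ℕ) : MvPolynomial (Fin n) ℚ →ₗ[ℚ] ℚ :=
  MvPolynomial.lcoeff ℚ (indExp univ)

theorem coeffOnes_prod {n p : ℕ} (g : Perm (Fin n)) (l : Fin p → ℕ) :
    coeffOnes n (∏ i, invSubsetPoly g (l i)) = permChar n (extc l) g := by
  simp only [invSubsetPoly, coeffOnes]
  rw [Finset.prod_univ_sum, permChar_extc, map_sum]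
  simp only [← MvPolynomial.monomial_sum_one, MvPolynomial.lcoeff_apply,
    MvPolynomial.coeff_monomial]
  rw [Finset.sum_boole, ← Nat.card_eq_finsetCard, Nat.cast_inj]
  symm
  refine Nat.card_eq_of_bijective (fun f => ⟨fun i => univ.filter fun x => f.1 x = i, ?_⟩) ⟨?_, ?_⟩
  · obtain ⟨f, hf, hg⟩ := f
    simp only [Finset.mem_filter, Fintype.mem_piFinset, Finset.mem_univ, true_and, hg,
      implies_true, and_true]
    refine ⟨fun i => ?_, ?_⟩
    · rw [← hf i, Nat.card_eq_fintype_card, Fintype.card_subtype]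
    · ext x
      simp [Finsupp.finsetSum_apply, indExp_apply]
  · intro f f' h
    apply Subtype.ext
    funext x
    have := congrFun (congrArg Subtype.val h) (f'.1 x)
    have := (Finset.ext_iff.1 this x).2 (by simp)
    simpa using this
  · rintro ⟨S, hS⟩
    simp only [Finset.mem_filter, Fintype.mem_piFinset, Finset.mem_univ, true_and] at hS
    obtain ⟨hS, hsum⟩ := hS
    have hx : ∀ x, ∃ i, ∀ j, x ∈ S j ↔ i = j := by
      intro x
      have h1 := DFunLike.congr_fun hsum x
      simp only [Finsupp.finsetSum_apply, indExp_apply, Finset.mem_univ, if_true,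
        Finset.sum_boole, Nat.cast_id] at h1
      obtain ⟨i, hi⟩ := Finset.card_eq_one.1 h1
      refine ⟨i, fun j => ?_⟩
      have := Finset.ext_iff.1 hi j
      simp only [Finset.mem_filter, Finset.mem_univ, true_and, Finset.mem_singleton] at this
      rw [this, eq_comm]
    choose f hf using hx
    refine ⟨⟨f, fun k => ?_, fun x => ?_⟩, ?_⟩
    · have := (hS k).1
      rw [Nat.card_eq_fintype_card, Fintype.card_subtype, ← Nat.cast_inj (R := ℤ), ← this]
      congr 2
      ext x
      simp [hf]
    · exact (hf _ _).1 (((hS (f x)).2 x).2 ((hf _ _).2 rfl))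
    · apply Subtype.ext
      funext i
      ext x
      simp [hf]

theorem coeffOnes_prod_int {n p : ℕ} (g : Perm (Fin n)) (c : Fin p → ℤ) :
    coeffOnes n (∏ i, invSubsetPoly g (c i)) =
      permCharZ n (fun i => if h : i < p then c ⟨i, h⟩ else 0) g := by
  rw [permCharZ]
  split_ifs with hc
  · have hc' : ∀ i, c i = ((c i).toNat : ℕ) := fun i => by
      have := hc i
      simp only [i.2, dif_pos] at this
      exact (Int.toNat_of_nonneg this).symm
    rw [Finset.prod_congr rfl fun i _ => congrArg (invSubsetPoly g) (hc' i),
      coeffOnes_prod g fun i => (c i).toNat]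
    congr 1
    funext i
    rw [extc]
    split_ifs <;> rfl
  · push Not at hc
    obtain ⟨k, hk⟩ := hc
    by_cases hkp : k < p
    · rw [dif_pos hkp] at hk
      rw [Finset.prod_eq_zero (Finset.mem_univ (⟨k, hkp⟩ : Fin p))
        (invSubsetPoly_of_neg g _ hk), map_zero]
    · simp [hkp] at hk

theorem coeffOnes_jtDet {n : ℕ} (g : Perm (Fin n)) (a : Fin n → ℕ) :
    coeffOnes n (jtDet (invSubsetPoly g) a) = irrChar n (extc a) g := by
  rw [jtDet, Matrix.det_apply', map_sum, irrChar]
  refine Finset.sum_congr rfl fun σ _ => ?_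
  rw [← zsmul_eq_mul, map_zsmul, zsmul_eq_mul]
  congr 1
  simp only [Matrix.of_apply]
  rw [coeffOnes_prod_int g fun i => (a i : ℤ) - (i : ℕ) + (σ i : ℕ)]
  congr 1
  funext i
  split_ifs with h
  · simp [extc, h]
  · rfl

/-- Young's rule. -/
theorem permChar_eq_sum_kostka_mul_irrChar {n p : ℕ} (l : Fin p → ℕ) (hl : ∑ i, l i = n)
    (g : Perm (Fin n)) :
    permChar n (extc l) g = ∑ a ∈ (piAntidiag (univ : Finset (Fin n)) n).filter Antitone,
      (kostka (extc a) (extc l) : ℚ) * irrChar n (extc a) g := by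
  rw [← coeffOnes_prod, prod_eq_sum_kostka_mul_jtDet (invSubsetPoly g) (invSubsetPoly_zero g)
    (invSubsetPoly_of_neg g) l hl.le, map_sum, hl]
  refine Finset.sum_congr rfl fun a _ => ?_
  rw [← nsmul_eq_mul, map_nsmul, nsmul_eq_mul, coeffOnes_jtDet]

/-- The fiber sizes of a map. -/
noncomputable def fiberCount {n : ℕ} {Ω : Type*} (f : Fin n → Ω) (t : Ω) : ℕ := #{x | f x = t}

theorem fiberCount_comp {n : ℕ} {Ω : Type*} (f : Fin n → Ω) (g : Perm (Fin n)) :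
    fiberCount (f ∘ g) = fiberCount f := by
  funext t
  exact Finset.card_bij (fun x _ => g x) (by simp) (by simp)
    fun x hx => ⟨g.symm x, by simpa using hx⟩

theorem sum_fiberCount {n : ℕ} {Ω : Type*} [Fintype Ω] (f : Fin n → Ω) :
    ∑ t, fiberCount f t = n := by
  simp only [fiberCount]
  rw [← Finset.card_eq_sum_card_fiberwise (f := f) (s := univ) (t := univ) (by simp), card_univ,
    Fintype.card_fin]

theorem exists_perm_of_fiberCount_eq {n : ℕ} {Ω : Type*} {f f' : Fin n → Ω}
    (h : fiberCount f = fiberCount f') : ∃ g : Perm (Fin n), f' ∘ g = f := by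
  have e : ∀ t, Nonempty ({x // f x = t} ≃ {x // f' x = t}) := fun t => by
    rw [← Fintype.card_eq, Fintype.card_subtype, Fintype.card_subtype]
    exact congrFun h t
  refine ⟨Equiv.ofFiberEquiv fun t => (e t).some, ?_⟩
  funext x
  exact Equiv.ofFiberEquiv_map _ x

theorem exists_fiberCount_eq {n : ℕ} {Ω : Type*} [Fintype Ω] (A : Ω → ℕ) (hA : ∑ t, A t = n) :
    ∃ f : Fin n → Ω, fiberCount f = A := by
  have e : Fin n ≃ Σ t, Fin (A t) := Fintype.equivOfCardEq (by simp [hA])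
  refine ⟨fun x => (e x).1, ?_⟩
  funext t
  rw [fiberCount, ← Fintype.card_subtype, ← Fintype.card_fin (A t)]
  exact Fintype.card_congr ((e.subtypeEquiv (q := fun y => y.1 = t) fun x => Iff.rfl).trans
    (Equiv.sigmaSubtype t))

/-- Permutations acting on the maps whose fiber sizes satisfy a condition. -/
@[reducible] def permFiberAction {n : ℕ} {Ω : Type*} (P : (Ω → ℕ) → Prop) :
    MulAction (Perm (Fin n)) {f : Fin n → Ω // P (fiberCount f)} where
  smul g f := ⟨f.1 ∘ (g⁻¹ : Perm (Fin n)), by rw [fiberCount_comp]; exact f.2⟩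
  one_smul f := rfl
  mul_smul g g' f := Subtype.ext <| by
    change f.1 ∘ ((g * g')⁻¹ : Perm (Fin n)) = (f.1 ∘ (g'⁻¹ : Perm (Fin n))) ∘ (g⁻¹ : Perm (Fin n))
    rw [mul_inv_rev]
    rfl

/-- Counting the maps fixed by each permutation, with Burnside's lemma. -/
theorem sum_card_fixed_eq {n : ℕ} {Ω : Type*} [Fintype Ω] (P : (Ω → ℕ) → Prop) :
    ∑ g : Perm (Fin n), Nat.card {f : Fin n → Ω // P (fiberCount f) ∧ ∀ x, f (g x) = f x} =
      Nat.card {A : Ω → ℕ // ∑ t, A t = n ∧ P A} * n.factorial := by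
  let := permFiberAction (n := n) P
  have hB := MulAction.sum_card_fixedBy_eq_card_orbits_mul_card_group (Perm (Fin n))
    {f : Fin n → Ω // P (fiberCount f)}
  rw [Fintype.card_perm, Fintype.card_fin] at hB
  convert hB using 2
  · rename_i g _
    rw [← Nat.card_eq_fintype_card]
    refine Nat.card_congr ((Equiv.subtypeSubtypeEquivSubtypeInter _ _).symm.trans
      (Equiv.subtypeEquivRight fun f => ?_))
    rw [MulAction.mem_fixedBy, Subtype.ext_iff]
    change _ ↔ f.1 ∘ (g⁻¹ : Perm (Fin n)) = f.1
    rw [funext_iff]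
    refine ⟨fun h x => ?_, fun h x => ?_⟩
    · rw [Function.comp_apply, ← h]
      simp
    · rw [← h (g x)]
      simp
  · rw [← Nat.card_eq_fintype_card]
    symm
    refine Nat.card_eq_of_bijective (Quotient.lift (fun f => ⟨fiberCount f.1,
      sum_fiberCount f.1, f.2⟩) ?_) ⟨?_, ?_⟩
    · rintro _ f ⟨g, rfl⟩
      exact Subtype.ext (fiberCount_comp f.1 (g⁻¹ : Perm (Fin n)))
    · rintro ⟨f⟩ ⟨f'⟩ h
      obtain ⟨g, hg⟩ := exists_perm_of_fiberCount_eq (congrArg Subtype.val h)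
      refine Quotient.sound ⟨g⁻¹, Subtype.ext ?_⟩
      change f'.1 ∘ ((g⁻¹)⁻¹ : Perm (Fin n)) = f.1
      rw [inv_inv, hg]
    · rintro ⟨A, hA, hP⟩
      obtain ⟨f, rfl⟩ := exists_fiberCount_eq A hA
      exact ⟨Quotient.mk _ ⟨f, hP⟩, rfl⟩

/-- The three families of 1-marginals of a three-dimensional array. -/
def HasMarginals {p q r : ℕ} (l : Fin p → ℕ) (m : Fin q → ℕ) (ν : Fin r → ℕ)
    (A : Fin p × Fin q × Fin r → ℕ) : Prop :=
  (∀ i, ∑ j, ∑ k, A (i, j, k) = l i) ∧ (∀ j, ∑ i, ∑ k, A (i, j, k) = m j) ∧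
    ∀ k, ∑ i, ∑ j, A (i, j, k) = ν k

theorem hasMarginals_fiberCount_iff {n p q r : ℕ} (l : Fin p → ℕ) (m : Fin q → ℕ)
    (ν : Fin r → ℕ) (f : Fin n → Fin p × Fin q × Fin r) :
    HasMarginals l m ν (fiberCount f) ↔ (∀ i, Nat.card {x // (f x).1 = i} = l i) ∧
      (∀ j, Nat.card {x // (f x).2.1 = j} = m j) ∧ ∀ k, Nat.card {x // (f x).2.2 = k} = ν k := by
  have h1 : ∀ i, ∑ j, ∑ k, fiberCount f (i, j, k) = Nat.card {x // (f x).1 = i} := fun i => by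
    rw [Nat.card_eq_fintype_card, Fintype.card_subtype, ← Fintype.sum_prod_type',
      Finset.card_eq_sum_card_fiberwise (f := fun x => (f x).2) (t := univ) (by simp)]
    simp only [fiberCount, Finset.filter_filter, Prod.ext_iff]
  have h2 : ∀ j, ∑ i, ∑ k, fiberCount f (i, j, k) = Nat.card {x // (f x).2.1 = j} := fun j => by
    rw [Nat.card_eq_fintype_card, Fintype.card_subtype,
      ← Fintype.sum_prod_type' (f := fun i k => fiberCount f (i, j, k)),
      Finset.card_eq_sum_card_fiberwise (f := fun x => ((f x).1, (f x).2.2)) (t := univ) (by simp)]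
    simp only [fiberCount, Finset.filter_filter, Prod.ext_iff, and_left_comm]
  have h3 : ∀ k, ∑ i, ∑ j, fiberCount f (i, j, k) = Nat.card {x // (f x).2.2 = k} := fun k => by
    rw [Nat.card_eq_fintype_card, Fintype.card_subtype,
      ← Fintype.sum_prod_type' (f := fun i j => fiberCount f (i, j, k)),
      Finset.card_eq_sum_card_fiberwise (f := fun x => ((f x).1, (f x).2.1)) (t := univ) (by simp)]
    simp only [fiberCount, Finset.filter_filter, Prod.ext_iff]
    refine Finset.sum_congr rfl fun x _ => congrArg Finset.card ?_
    ext y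
    simp only [Finset.mem_filter, Finset.mem_univ, true_and]
    tauto
  simp only [HasMarginals, h1, h2, h3]

theorem card_fixed_eq_permChar {n p q r : ℕ} (l : Fin p → ℕ) (m : Fin q → ℕ)
    (ν : Fin r → ℕ) (g : Perm (Fin n)) :
    (Nat.card {f : Fin n → Fin p × Fin q × Fin r //
      HasMarginals l m ν (fiberCount f) ∧ ∀ x, f (g x) = f x} : ℚ) =
      permChar n (extc l) g * permChar n (extc m) g * permChar n (extc ν) g := by
  simp only [permChar_extc, ← Nat.cast_mul, ← Nat.card_prod, hasMarginals_fiberCount_iff]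
  rw [Nat.cast_inj]
  refine Nat.card_congr
    { toFun := fun f => ((⟨fun x => (f.1 x).1, f.2.1.1, fun x => congrArg (·.1) (f.2.2 x)⟩,
        ⟨fun x => (f.1 x).2.1, f.2.1.2.1, fun x => congrArg (·.2.1) (f.2.2 x)⟩),
        ⟨fun x => (f.1 x).2.2, f.2.1.2.2, fun x => congrArg (·.2.2) (f.2.2 x)⟩)
      invFun := fun F => ⟨fun x => (F.1.1.1 x, F.1.2.1 x, F.2.1 x),
        ⟨F.1.1.2.1, F.1.2.2.1, F.2.2.1⟩, fun x =>
          Prod.ext (F.1.1.2.2 x) (Prod.ext (F.1.2.2.2 x) (F.2.2.2 x))⟩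
      left_inv := fun f => rfl
      right_inv := fun F => rfl }

theorem card_marginals {n p q r : ℕ} (l : Fin p → ℕ) (m : Fin q → ℕ) (ν : Fin r → ℕ)
    (hl : ∑ i, l i = n) :
    (Nat.card {A : Fin p → Fin q → Fin r → ℕ //
        (∀ i, ∑ j, ∑ k, A i j k = l i) ∧ (∀ j, ∑ i, ∑ k, A i j k = m j) ∧
        (∀ k, ∑ i, ∑ j, A i j k = ν k)} : ℚ) =
      (∑ g : Perm (Fin n), permChar n (extc l) g * permChar n (extc m) g * permChar n (extc ν) g) /
        n.factorial := by
  rw [eq_div_iff (by exact_mod_cast n.factorial_ne_zero)]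
  simp only [← card_fixed_eq_permChar]
  rw [← Nat.cast_sum, sum_card_fixed_eq, Nat.cast_mul]
  congr 2
  refine Nat.card_congr
    { toFun := fun A => ⟨fun t => A.1 t.1 t.2.1 t.2.2, ?_, A.2⟩
      invFun := fun A => ⟨fun i j k => A.1 (i, j, k), A.2.2⟩
      left_inv := fun A => rfl
      right_inv := fun A => rfl }
  simp only [Fintype.sum_prod_type, A.2.1, hl]

theorem card_parts_le {n : ℕ} (P : n.Partition) : P.parts.card ≤ n := by
  have := Multiset.card_nsmul_le_sum (s := P.parts) (a := 1) fun x hx => P.parts_pos hx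
  simpa [P.parts_sum] using this

theorem pf_eq_extc_pfin {n : ℕ} (P : n.Partition) : pf P = extc (pfin P) := by
  funext i
  rw [extc]
  split_ifs with h
  · rfl
  · rw [pf, List.getD_eq_default]
    have := card_parts_le P
    simp
    omega

theorem getD_filter_ne_zero {L : List ℕ} (hL : L.Pairwise (· ≥ ·)) (i : ℕ) :
    (L.filter (· ≠ 0)).getD i 0 = L.getD i 0 := by
  induction L generalizing i with
  | nil => rfl
  | cons x L ih =>
    rw [List.pairwise_cons] at hL
    rcases Nat.eq_zero_or_pos x with rfl | hx
    · have h0 : ∀ y ∈ L, y = 0 := fun y hy => Nat.le_zero.1 (hL.1 y hy)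
      rw [List.filter_eq_nil_iff.2 (by simpa using h0)]
      cases i with
      | zero => rfl
      | succ i =>
        rw [List.getD_cons_succ]
        by_cases hi : i < L.length
        · rw [List.getD_eq_getElem _ _ hi, h0 _ (List.getElem_mem hi)]
          rfl
        · rw [List.getD_eq_default _ _ (not_lt.1 hi)]
          rfl
    · rw [List.filter_cons_of_pos (by simpa using hx.ne')]
      cases i with
      | zero => rfl
      | succ i => simpa only [List.getD_cons_succ] using ih hL.2 i

theorem pairwise_ge_parts {n : ℕ} (P : n.Partition) :
    (P.parts.sort (· ≤ ·)).reverse.Pairwise (· ≥ ·) := by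
  rw [List.pairwise_reverse]
  exact Multiset.pairwise_sort _ _

theorem pfin_ofSums {n : ℕ} {a : Fin n → ℕ} (ha : Antitone a) (hsum : ∑ i, a i = n) :
    pfin (Nat.Partition.ofSums n (univ.val.map a) hsum) = a := by
  have hL : (List.ofFn a).Pairwise (· ≥ ·) := by
    rw [List.pairwise_ofFn]
    exact fun i j hij => ha hij.le
  have hs : ((Nat.Partition.ofSums n (univ.val.map a) hsum).parts.sort (· ≤ ·)).reverse =
      (List.ofFn a).filter (· ≠ 0) := by
    refine List.Perm.eq_of_pairwise (le := (· ≥ ·)) (fun a b _ _ h1 h2 => le_antisymm h2 h1)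
      (pairwise_ge_parts _) (hL.filter _)
      ((List.reverse_perm _).trans (Multiset.coe_eq_coe.1 ?_))
    rw [Multiset.sort_eq, ← Multiset.filter_coe, List.ofFn_eq_map, ← Multiset.map_coe]
    rfl
  funext i
  rw [pfin, pf, hs, getD_filter_ne_zero hL]
  simp

theorem antitone_pfin {n : ℕ} (P : n.Partition) : Antitone (pfin P) := by
  intro i j hij
  rcases hij.eq_or_lt with rfl | hij
  · exact le_rfl
  simp only [pfin, pf]
  by_cases hj : (j : ℕ) < (P.parts.sort (· ≤ ·)).reverse.length
  · rw [List.getD_eq_getElem _ _ hj, List.getD_eq_getElem _ _ (lt_trans hij hj)]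
    exact List.pairwise_iff_getElem.1 (pairwise_ge_parts P) i j _ hj hij
  · rw [List.getD_eq_default _ _ (not_lt.1 hj)]
    exact Nat.zero_le _

theorem sum_range_getD {L : List ℕ} {n : ℕ} (h : L.length ≤ n) :
    ∑ i ∈ range n, L.getD i 0 = L.sum := by
  induction L generalizing n with
  | nil => simp
  | cons x L ih =>
    cases n with
    | zero => simp at h
    | succ n =>
      rw [Finset.sum_range_succ', List.sum_cons, ← ih (Nat.le_of_succ_le_succ h), add_comm]
      rfl

theorem sum_pfin {n : ℕ} (P : n.Partition) : ∑ i, pfin P i = n := by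
  change ∑ i : Fin n, pf P i = n
  rw [Fin.sum_univ_eq_sum_range (pf P)]
  simp only [pf]
  rw [sum_range_getD (by simpa using card_parts_le P), List.sum_reverse, ← Multiset.sum_coe,
    Multiset.sort_eq, P.parts_sum]

theorem eq_of_getD_eq {L L' : List ℕ} (hL : ∀ x ∈ L, 0 < x) (hL' : ∀ x ∈ L', 0 < x)
    (h : ∀ i, L.getD i 0 = L'.getD i 0) : L = L' := by
  induction L generalizing L' with
  | nil =>
    cases L' with
    | nil => rfl
    | cons x L' => exact absurd (h 0) (hL' x (by simp)).ne
  | cons x L ih =>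
    cases L' with
    | nil => exact absurd (h 0) (hL x (by simp)).ne'
    | cons y L' =>
      rw [show x = y from h 0, ih (fun z hz => hL z (List.mem_cons_of_mem _ hz))
        (fun z hz => hL' z (List.mem_cons_of_mem _ hz)) fun i => h (i + 1)]

theorem pfin_injective {n : ℕ} : Function.Injective (pfin (n := n)) := by
  intro P Q h
  have hpf : pf P = pf Q := by rw [pf_eq_extc_pfin, h, ← pf_eq_extc_pfin]
  have hpos : ∀ R : n.Partition, ∀ x ∈ (R.parts.sort (· ≤ ·)).reverse, 0 < x := fun R x hx =>
    R.parts_pos (by simpa using hx)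
  have := List.reverse_injective (eq_of_getD_eq (hpos P) (hpos Q) (congrFun hpf))
  apply Nat.Partition.ext
  rw [← Multiset.sort_eq P.parts (· ≤ ·), this, Multiset.sort_eq]

theorem sum_partition_pf {n : ℕ} {M : Type*} [AddCommMonoid M] (F : (ℕ → ℕ) → M) :
    ∑ P : n.Partition, F (pf P) =
      ∑ a ∈ (piAntidiag (univ : Finset (Fin n)) n).filter Antitone, F (extc a) := by
  refine Finset.sum_nbij pfin ?_ (pfin_injective.injOn) ?_ ?_
  · intro P _
    simp only [Finset.mem_filter, mem_piAntidiag]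
    exact ⟨⟨sum_pfin P, by simp⟩, antitone_pfin P⟩
  · intro a ha
    simp only [Finset.coe_filter, mem_piAntidiag, Set.mem_ofPred_eq] at ha
    exact ⟨_, by simp, pfin_ofSums ha.2 ha.1.1⟩
  · intro P _
    rw [pf_eq_extc_pfin]

/-- `m(l,m,ν) = ∑_{α,β,γ ⊢ n} K_{αl} K_{βm} K_{γν} k(α,β,γ)`. -/
theorem stmt6 (n p q r : ℕ) (l : Fin p → ℕ) (m : Fin q → ℕ) (ν : Fin r → ℕ)
    (hl : ∑ i, l i = n) (hm : ∑ j, m j = n) (hν : ∑ k, ν k = n) :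
    (Nat.card {A : Fin p → Fin q → Fin r → ℕ //
        (∀ i, ∑ j, ∑ k, A i j k = l i) ∧ (∀ j, ∑ i, ∑ k, A i j k = m j) ∧
        (∀ k, ∑ i, ∑ j, A i j k = ν k)} : ℚ) =
      ∑ α : n.Partition, ∑ β : n.Partition, ∑ γ : n.Partition,
        (kostka (pf α) (extc l) : ℚ) * (kostka (pf β) (extc m) : ℚ) *
          (kostka (pf γ) (extc ν) : ℚ) * kron n (pf α) (pf β) (pf γ) := by
  have young : ∀ {s : ℕ} (c : Fin s → ℕ), ∑ i, c i = n → ∀ g : Perm (Fin n),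
      permChar n (extc c) g =
        ∑ α : n.Partition, (kostka (pf α) (extc c) : ℚ) * irrChar n (pf α) g :=
    fun c hc g => by
      rw [permChar_eq_sum_kostka_mul_irrChar c hc g,
        sum_partition_pf fun a => (kostka a (extc c) : ℚ) * irrChar n a g]
  have expand : ∀ u v w : n.Partition → ℚ, (∑ α, u α) * (∑ β, v β) * (∑ γ, w γ) =
      ∑ α, ∑ β, ∑ γ, u α * v β * w γ := fun u v w => by
    rw [Finset.sum_mul_sum, Finset.sum_mul]
    refine Finset.sum_congr rfl fun α _ => ?_
    rw [Finset.sum_mul]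
    exact Finset.sum_congr rfl fun β _ => Finset.mul_sum _ _ _
  rw [card_marginals l m ν hl]
  simp only [young l hl, young m hm, young ν hν, expand, Finset.sum_div]
  rw [Finset.sum_comm]
  refine Finset.sum_congr rfl fun α _ => ?_
  rw [Finset.sum_comm]
  refine Finset.sum_congr rfl fun β _ => ?_
  rw [Finset.sum_comm]
  refine Finset.sum_congr rfl fun γ _ => ?_
  rw [kron, innerChar, Finset.sum_div, Finset.mul_sum]
  refine Finset.sum_congr rfl fun g _ => ?_
  ring
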